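/- Let B be the quotient of the free associative algebra k⟨x1,y,x2,u⟩ by the two-sided ideal generated by: x1², y², x1·y + y·x1; x1·x2 − q·x2·x1; z²; x2·z − q⁻¹·z·x2; x1·u − q·(u − (1/2)·x2)·x1 + (1/2)·z; t·x2 − q·x2·t; t·u − q·(u + (1/2)·x2)·t; t²; t·z + z·t; u·x2 − x2·u + (1/2)·x2². Then the images in B of the monomials u^{m1}·x2^{m2}·t^{m3}·z^{m4}·y^{m5}·x1^{m6}, where m3,m4,m5,m6 ∈ {0,1} and m1,m2 ∈ ℕ, form a k-vector space basis of B. -/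

import Mathlib

/- Statement 15: PBW basis of the Nichols algebra 𝔅(𝔖_{1,+}(q,−1/2)) (Theorem 6.4, case 𝒢 = 1). -/

noncomputable section
namespace Stmt15

variable (k : Type*) [Field k] (q : k)

def x1 : FreeAlgebra k (Fin 4) := FreeAlgebra.ι k 0
/-- `y` stands for the generator x_{3/2} of the paper. -/
def y : FreeAlgebra k (Fin 4) := FreeAlgebra.ι k 1
def x2 : FreeAlgebra k (Fin 4) := FreeAlgebra.ι k 2
/-- `u` stands for the generator x_{5/2} of the paper. -/
def u : FreeAlgebra k (Fin 4) := FreeAlgebra.ι k 3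

/-- z := y·x2 − q·x2·y (the element x_{3/2 2}) -/
def z : FreeAlgebra k (Fin 4) := y k * x2 k - q • (x2 k * y k)
/-- t := y·u − q·(u − (1/2)·x2)·y (the element x_{3/2 5/2}) -/
def t : FreeAlgebra k (Fin 4) := y k * u k - q • ((u k - (2 : k)⁻¹ • x2 k) * y k)

def rels : Set (FreeAlgebra k (Fin 4)) :=
  { x1 k ^ 2, y k ^ 2, x1 k * y k + y k * x1 k,
    x1 k * x2 k - q • (x2 k * x1 k),
    z k q ^ 2,
    x2 k * z k q - q⁻¹ • (z k q * x2 k),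
    x1 k * u k - q • ((u k - (2 : k)⁻¹ • x2 k) * x1 k) + (2 : k)⁻¹ • z k q,
    t k q * x2 k - q • (x2 k * t k q),
    t k q * u k - q • ((u k + (2 : k)⁻¹ • x2 k) * t k q),
    t k q ^ 2,
    t k q * z k q + z k q * t k q,
    u k * x2 k - x2 k * u k + (2 : k)⁻¹ • x2 k ^ 2 }

def rel (a b : FreeAlgebra k (Fin 4)) : Prop := a ∈ rels k q ∧ b = 0

/-- The index set of the PBW monomials. -/
structure Idx where
  m1 : ℕ
  m2 : ℕ
  m3 : Fin 2
  m4 : Fin 2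
  m5 : Fin 2
  m6 : Fin 2

/-- The PBW monomials u^{m1}·x2^{m2}·t^{m3}·z^{m4}·y^{m5}·x1^{m6}. -/
def mon (i : Idx) : RingQuot (rel k q) :=
  RingQuot.mkAlgHom k (rel k q)
    (u k ^ i.m1 * x2 k ^ i.m2 * t k q ^ (i.m3 : ℕ) * z k q ^ (i.m4 : ℕ) *
      y k ^ (i.m5 : ℕ) * x1 k ^ (i.m6 : ℕ))

variable {k} in
/-- The basis vector of the model `Idx →₀ k` that corresponds to a PBW monomial. -/
def e (a b : ℕ) (c d r s : Fin 2) : Idx →₀ k := Finsupp.single ⟨a, b, c, d, r, s⟩ 1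

variable {k} in
/-- The linear endomorphism of the model with prescribed values on the basis. -/
def ofBasis (f : ℕ → ℕ → Fin 2 → Fin 2 → Fin 2 → Fin 2 → (Idx →₀ k)) : Module.End k (Idx →₀ k) :=
  Finsupp.linearCombination k fun i => f i.m1 i.m2 i.m3 i.m4 i.m5 i.m6

variable {k} in
@[simp]
lemma ofBasis_e (f : ℕ → ℕ → Fin 2 → Fin 2 → Fin 2 → Fin 2 → (Idx →₀ k)) (a b c d r s) :
    ofBasis f (e a b c d r s) = f a b c d r s := by
  simp [ofBasis, e]

variable {k} in
lemma hom_ext_e {M : Type*} [AddCommMonoid M] [Module k M] {f g : (Idx →₀ k) →ₗ[k] M}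
    (h : ∀ a b c d r s, f (e a b c d r s) = g (e a b c d r s)) : f = g :=
  Finsupp.lhom_ext' fun i => LinearMap.ext_ring (h i.m1 i.m2 i.m3 i.m4 i.m5 i.m6)

/-- Inserting a factor `z` between `t^c z^d` and `y^r x1^s`. -/
def insZ (a b : ℕ) (c d r s : Fin 2) : Idx →₀ k := if d = 0 then e a b c 1 r s else 0

/-- Inserting a factor `t` between `t^c z^d` and `y^r x1^s`. -/
def insT (a b : ℕ) (c d r s : Fin 2) : Idx →₀ k :=
  if c = 0 then (-1 : k) ^ (d : ℕ) • e a b 1 d r s else 0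

/-- Inserting a factor `x2` between `t^c z^d` and `y^r x1^s`. -/
def insX (a b : ℕ) (c d r s : Fin 2) : Idx →₀ k :=
  q ^ ((c : ℕ) + d) • e a (b + 1) c d r s

/-- Inserting a factor `u` between `t^c z^d` and `y^r x1^s`. -/
def insU (a b : ℕ) (c d r s : Fin 2) : Idx →₀ k :=
  q ^ ((c : ℕ) + d) • (e (a + 1) b c d r s +
    ((2 : k)⁻¹ * (b + (c : ℕ) + (d : ℕ))) • e a (b + 1) c d r s)

/-- Right multiplication by `x1`. -/
def rx1 : Module.End k (Idx →₀ k) :=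
  ofBasis fun a b c d r s => if s = 0 then e a b c d r 1 else 0

/-- Right multiplication by `y`. -/
def ry : Module.End k (Idx →₀ k) :=
  ofBasis fun a b c d r s => if r = 0 then (-1 : k) ^ (s : ℕ) • e a b c d 1 s else 0

/-- Right multiplication by `x2`. -/
def rx2 : Module.End k (Idx →₀ k) :=
  ofBasis fun a b c d r s => q ^ ((r : ℕ) + s) • insX k q a b c d r s +
    if r = 0 then 0 else q ^ (s : ℕ) • insZ k a b c d 0 s

/-- Right multiplication by `u`. -/
def ru : Module.End k (Idx →₀ k) :=
  ofBasis fun a b c d r s =>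
    q ^ ((r : ℕ) + s) • (insU k q a b c d r s -
      ((2 : k)⁻¹ * ((r : ℕ) + (s : ℕ))) • insX k q a b c d r s) +
    (if r = 0 then 0 else q ^ (s : ℕ) • insT k a b c d 0 s) +
    if s = 0 then 0 else
      if r = 0 then -(2 : k)⁻¹ • insZ k a b c d 0 0
      else ((2 : k)⁻¹ * q) • (insZ k a b c d 1 0 - insZ k a b c d 0 1)

/-- Right multiplication by `z`. -/
def rz : Module.End k (Idx →₀ k) :=
  ofBasis fun a b c d r s => (-q) ^ ((r : ℕ) + s) • insZ k a b c d r s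

/-- Right multiplication by `t`. -/
def rt : Module.End k (Idx →₀ k) :=
  ofBasis fun a b c d r s => (-q) ^ ((r : ℕ) + s) • (insT k a b c d r s -
    ((2 : k)⁻¹ * ((r : ℕ) + (s : ℕ))) • insZ k a b c d r s)

lemma fin_two_cases (c : Fin 2) : c = 0 ∨ c = 1 := by omega

lemma rx2_mul_ry : rx2 k q * ry k - q • (ry k * rx2 k q) = rz k q := by
  refine hom_ext_e fun a b c d r s => ?_
  rcases fin_two_cases c with rfl | rfl <;> rcases fin_two_cases d with rfl | rfl <;>
  rcases fin_two_cases r with rfl | rfl <;> rcases fin_two_cases s with rfl | rfl <;>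
  simp [ry, rx2, rz, insX, insZ] <;>
  try (match_scalars <;> field_simp <;> ring)

lemma ru_mul_ry [CharZero k] :
    ru k q * ry k - q • (ry k * (ru k q - (2 : k)⁻¹ • rx2 k q)) = rt k q := by
  refine hom_ext_e fun a b c d r s => ?_
  rcases fin_two_cases c with rfl | rfl <;> rcases fin_two_cases d with rfl | rfl <;>
  rcases fin_two_cases r with rfl | rfl <;> rcases fin_two_cases s with rfl | rfl <;>
  simp [ry, rx2, ru, rt, insX, insZ, insU, insT] <;>
  try (match_scalars <;> field_simp <;> ring)

lemma rx1_mul_rx1 : rx1 k * rx1 k = 0 := by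
  refine hom_ext_e fun a b c d r s => ?_
  rcases fin_two_cases c with rfl | rfl <;> rcases fin_two_cases d with rfl | rfl <;>
  rcases fin_two_cases r with rfl | rfl <;> rcases fin_two_cases s with rfl | rfl <;>
  simp [rx1]

lemma ry_mul_ry : ry k * ry k = 0 := by
  refine hom_ext_e fun a b c d r s => ?_
  rcases fin_two_cases c with rfl | rfl <;> rcases fin_two_cases d with rfl | rfl <;>
  rcases fin_two_cases r with rfl | rfl <;> rcases fin_two_cases s with rfl | rfl <;>
  simp [ry]

lemma ry_mul_rx1 : ry k * rx1 k + rx1 k * ry k = 0 := by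
  refine hom_ext_e fun a b c d r s => ?_
  rcases fin_two_cases c with rfl | rfl <;> rcases fin_two_cases d with rfl | rfl <;>
  rcases fin_two_cases r with rfl | rfl <;> rcases fin_two_cases s with rfl | rfl <;>
  simp [rx1, ry]

lemma rx2_mul_rx1 : rx2 k q * rx1 k - q • (rx1 k * rx2 k q) = 0 := by
  refine hom_ext_e fun a b c d r s => ?_
  rcases fin_two_cases c with rfl | rfl <;> rcases fin_two_cases d with rfl | rfl <;>
  rcases fin_two_cases r with rfl | rfl <;> rcases fin_two_cases s with rfl | rfl <;>
  simp [rx1, rx2, insX, insZ] <;>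
  try (match_scalars; field_simp; ring)

lemma rz_mul_rz : rz k q * rz k q = 0 := by
  refine hom_ext_e fun a b c d r s => ?_
  rcases fin_two_cases c with rfl | rfl <;> rcases fin_two_cases d with rfl | rfl <;>
  rcases fin_two_cases r with rfl | rfl <;> rcases fin_two_cases s with rfl | rfl <;>
  simp [rz, insZ]

lemma rz_mul_rx2 (hq : q ≠ 0) : rz k q * rx2 k q - q⁻¹ • (rx2 k q * rz k q) = 0 := by
  refine hom_ext_e fun a b c d r s => ?_
  rcases fin_two_cases c with rfl | rfl <;> rcases fin_two_cases d with rfl | rfl <;>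
  rcases fin_two_cases r with rfl | rfl <;> rcases fin_two_cases s with rfl | rfl <;>
  simp [rx2, rz, insX, insZ] <;>
  try (match_scalars; field_simp; ring)

lemma ru_mul_rx1 [CharZero k] :
    ru k q * rx1 k - q • (rx1 k * (ru k q - (2 : k)⁻¹ • rx2 k q)) + (2 : k)⁻¹ • rz k q = 0 := by
  refine hom_ext_e fun a b c d r s => ?_
  rcases fin_two_cases c with rfl | rfl <;> rcases fin_two_cases d with rfl | rfl <;>
  rcases fin_two_cases r with rfl | rfl <;> rcases fin_two_cases s with rfl | rfl <;>
  simp [rx1, rx2, ru, rz, insX, insZ, insU, insT] <;>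
  try (match_scalars <;> field_simp <;> ring)

lemma rx2_mul_rt [CharZero k] : rx2 k q * rt k q - q • (rt k q * rx2 k q) = 0 := by
  refine hom_ext_e fun a b c d r s => ?_
  rcases fin_two_cases c with rfl | rfl <;> rcases fin_two_cases d with rfl | rfl <;>
  rcases fin_two_cases r with rfl | rfl <;> rcases fin_two_cases s with rfl | rfl <;>
  simp [rx2, rt, insX, insZ, insT] <;>
  try (match_scalars <;> field_simp <;> ring)

lemma ru_mul_rt [CharZero k] :
    ru k q * rt k q - q • (rt k q * (ru k q + (2 : k)⁻¹ • rx2 k q)) = 0 := by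
  refine hom_ext_e fun a b c d r s => ?_
  rcases fin_two_cases c with rfl | rfl <;> rcases fin_two_cases d with rfl | rfl <;>
  rcases fin_two_cases r with rfl | rfl <;> rcases fin_two_cases s with rfl | rfl <;>
  simp [rx2, ru, rt, insX, insZ, insU, insT] <;>
  try (match_scalars <;> field_simp <;> ring)

lemma rt_mul_rt [CharZero k] : rt k q * rt k q = 0 := by
  refine hom_ext_e fun a b c d r s => ?_
  rcases fin_two_cases c with rfl | rfl <;> rcases fin_two_cases d with rfl | rfl <;>
  rcases fin_two_cases r with rfl | rfl <;> rcases fin_two_cases s with rfl | rfl <;>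
  simp [rt, insT, insZ] <;>
  first
  | (right; module)
  | module

lemma rz_mul_rt [CharZero k] : rz k q * rt k q + rt k q * rz k q = 0 := by
  refine hom_ext_e fun a b c d r s => ?_
  rcases fin_two_cases c with rfl | rfl <;> rcases fin_two_cases d with rfl | rfl <;>
  rcases fin_two_cases r with rfl | rfl <;> rcases fin_two_cases s with rfl | rfl <;>
  simp [rz, rt, insZ, insT]

lemma rx2_mul_ru [CharZero k] :
    rx2 k q * ru k q - ru k q * rx2 k q + (2 : k)⁻¹ • (rx2 k q * rx2 k q) = 0 := by
  refine hom_ext_e fun a b c d r s => ?_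
  rcases fin_two_cases c with rfl | rfl <;> rcases fin_two_cases d with rfl | rfl <;>
  rcases fin_two_cases r with rfl | rfl <;> rcases fin_two_cases s with rfl | rfl <;>
  simp [rx2, ru, insX, insZ, insU, insT] <;>
  try (match_scalars <;> field_simp <;> ring)

/-- The straightening rules for the generators `x1, y, x2, u` and the elements `z, t`. -/
structure Straightening {R : Type*} [Ring R] [Algebra k R] (X1 Y X2 U Z T : R) : Prop where
  x1_x1 : X1 * X1 = 0
  y_y : Y * Y = 0
  x1_y : X1 * Y = -(Y * X1)
  y_x2 : Y * X2 = q • (X2 * Y) + Z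
  y_u : Y * U = q • (U * Y) - (q * 2⁻¹) • (X2 * Y) + T
  x1_x2 : X1 * X2 = q • (X2 * X1)
  x1_u : X1 * U = q • (U * X1) - (q * 2⁻¹) • (X2 * X1) - (2 : k)⁻¹ • Z
  z_z : Z * Z = 0
  t_t : T * T = 0
  z_t : Z * T = -(T * Z)
  z_x2 : Z * X2 = q • (X2 * Z)
  t_x2 : T * X2 = q • (X2 * T)
  t_u : T * U = q • (U * T) + (q * 2⁻¹) • (X2 * T)
  x2_u : X2 * U = U * X2 + (2 : k)⁻¹ • (X2 * X2)

lemma mul_mul_of_mul_eq {R : Type*} [Semigroup R] {a b c : R} (h : a * b = c) (w : R) :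
    a * (b * w) = c * w := by
  rw [← mul_assoc, h]

namespace Straightening

variable {k q}
variable {R : Type*} [Ring R] [Algebra k R] {X1 Y X2 U Z T : R}

lemma y_z (h : Straightening k q X1 Y X2 U Z T) : Y * Z = -q • (Z * Y) := by
  have hz : Z = Y * X2 - q • (X2 * Y) := by rw [h.y_x2]; abel
  have h1 : Y * (Y * X2) = 0 := by rw [← mul_assoc, h.y_y, zero_mul]
  have h2 : X2 * (Y * Y) = 0 := by rw [h.y_y, mul_zero]
  simp [hz, mul_sub, sub_mul, mul_assoc, h1, h2]

lemma z_u [CharZero k] (h : Straightening k q X1 Y X2 U Z T) :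
    Z * U = q • (U * Z) + (q * 2⁻¹) • (X2 * Z) := by
  have hz : Z = Y * X2 - q • (X2 * Y) := by rw [h.y_x2]; abel
  have hU : Z * U = Y * (X2 * U) - q • (X2 * (Y * U)) := by
    simp only [hz, sub_mul, mul_assoc, smul_mul_assoc]
  rw [hU, h.x2_u, h.y_u]
  simp only [mul_add, mul_sub, mul_smul_comm, mul_mul_of_mul_eq h.y_u,
    mul_mul_of_mul_eq h.y_x2, h.y_x2, mul_mul_of_mul_eq h.x2_u, add_mul, sub_mul, smul_mul_assoc,
    mul_assoc, h.z_x2, h.t_x2]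
  match_scalars <;> field_simp <;> ring

lemma x2_pow_u [CharZero k] (h : Straightening k q X1 Y X2 U Z T) (b : ℕ) :
    X2 ^ b * U = U * X2 ^ b + ((2 : k)⁻¹ * b) • X2 ^ (b + 1) := by
  induction b with
  | zero => simp
  | succ b ih =>
    rw [pow_succ', mul_assoc, ih, mul_add, ← mul_assoc, h.x2_u, mul_smul_comm, ← pow_succ',
      add_mul, smul_mul_assoc, mul_assoc, mul_assoc, ← pow_succ', ← pow_succ']
    push_cast
    module

/-- The linear map from the model sending basis vectors to PBW monomials. -/
def toAlg (_ : Straightening k q X1 Y X2 U Z T) : (Idx →₀ k) →ₗ[k] R :=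
  Finsupp.linearCombination k fun i =>
    U ^ i.m1 * X2 ^ i.m2 * T ^ (i.m3 : ℕ) * Z ^ (i.m4 : ℕ) * Y ^ (i.m5 : ℕ) * X1 ^ (i.m6 : ℕ)

lemma toAlg_e (h : Straightening k q X1 Y X2 U Z T) (a b : ℕ) (c d r s : Fin 2) :
    h.toAlg (e a b c d r s) = U ^ a * X2 ^ b *
      (T ^ (c : ℕ) * (Z ^ (d : ℕ) * (Y ^ (r : ℕ) * X1 ^ (s : ℕ)))) := by
  simp [toAlg, e, mul_assoc]

lemma toAlg_rx1 (h : Straightening k q X1 Y X2 U Z T) (v : Idx →₀ k) :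
    h.toAlg (rx1 k v) = h.toAlg v * X1 := by
  refine LinearMap.congr_fun (f := h.toAlg ∘ₗ rx1 k) (g := LinearMap.mulRight k X1 ∘ₗ h.toAlg)
    (hom_ext_e fun a b c d r s => ?_) v
  rcases fin_two_cases s with rfl | rfl <;>
  simp [rx1, toAlg_e, mul_assoc, h.x1_x1]

lemma toAlg_ry (h : Straightening k q X1 Y X2 U Z T) (v : Idx →₀ k) :
    h.toAlg (ry k v) = h.toAlg v * Y := by
  refine LinearMap.congr_fun (f := h.toAlg ∘ₗ ry k) (g := LinearMap.mulRight k Y ∘ₗ h.toAlg)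
    (hom_ext_e fun a b c d r s => ?_) v
  rcases fin_two_cases r with rfl | rfl <;> rcases fin_two_cases s with rfl | rfl <;>
  simp [ry, toAlg_e, mul_assoc, h.x1_y, h.y_y, mul_mul_of_mul_eq h.y_y]

lemma toAlg_rx2 (h : Straightening k q X1 Y X2 U Z T) (v : Idx →₀ k) :
    h.toAlg (rx2 k q v) = h.toAlg v * X2 := by
  refine LinearMap.congr_fun (f := h.toAlg ∘ₗ rx2 k q) (g := LinearMap.mulRight k X2 ∘ₗ h.toAlg)
    (hom_ext_e fun a b c d r s => ?_) v
  have hM : U ^ a * X2 ^ b * X2 = U ^ a * X2 ^ (b + 1) := by rw [mul_assoc, ← pow_succ]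
  simp only [LinearMap.comp_apply, LinearMap.mulRight_apply, rx2, insX, insZ, ofBasis_e, map_add,
    map_smul, toAlg_e, apply_ite h.toAlg, map_zero, ← hM]
  generalize U ^ a * X2 ^ b = M
  rcases fin_two_cases c with rfl | rfl <;> rcases fin_two_cases d with rfl | rfl <;>
  rcases fin_two_cases r with rfl | rfl <;> rcases fin_two_cases s with rfl | rfl <;>
  simp [mul_assoc, mul_add, add_mul, h.y_x2, h.x1_x2, h.z_x2, h.t_x2, h.z_z,
    mul_mul_of_mul_eq h.y_x2, mul_mul_of_mul_eq h.z_x2, mul_mul_of_mul_eq h.t_x2,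
    mul_mul_of_mul_eq h.z_z] <;>
  try module

lemma toAlg_ru [CharZero k] (h : Straightening k q X1 Y X2 U Z T) (v : Idx →₀ k) :
    h.toAlg (ru k q v) = h.toAlg v * U := by
  refine LinearMap.congr_fun (f := h.toAlg ∘ₗ ru k q) (g := LinearMap.mulRight k U ∘ₗ h.toAlg)
    (hom_ext_e fun a b c d r s => ?_) v
  have hM : U ^ a * X2 ^ b * X2 = U ^ a * X2 ^ (b + 1) := by rw [mul_assoc, ← pow_succ]
  have hU : U ^ (a + 1) * X2 ^ b =
      U ^ a * X2 ^ b * U - ((2 : k)⁻¹ * b) • (U ^ a * X2 ^ b * X2) := by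
    rw [hM, mul_assoc _ _ U, h.x2_pow_u, mul_add, ← mul_assoc, ← pow_succ, mul_smul_comm,
      add_sub_cancel_right]
  simp only [LinearMap.comp_apply, LinearMap.mulRight_apply, ru, insX, insZ, insT, insU, ofBasis_e,
    map_add, map_sub, map_smul, toAlg_e, apply_ite h.toAlg, map_zero, hU, ← hM]
  generalize U ^ a * X2 ^ b = M
  rcases fin_two_cases c with rfl | rfl <;> rcases fin_two_cases d with rfl | rfl <;>
  rcases fin_two_cases r with rfl | rfl <;> rcases fin_two_cases s with rfl | rfl <;>
  simp [mul_assoc, mul_add, add_mul, mul_sub, sub_mul, h.z_z, h.y_u, h.x1_u, h.z_u, h.t_u, h.t_t,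
    h.z_t, h.y_z, mul_mul_of_mul_eq h.y_x2, mul_mul_of_mul_eq h.z_x2, mul_mul_of_mul_eq h.t_x2,
    mul_mul_of_mul_eq h.z_z, mul_mul_of_mul_eq h.y_u, mul_mul_of_mul_eq h.z_u,
    mul_mul_of_mul_eq h.t_u, mul_mul_of_mul_eq h.t_t, mul_mul_of_mul_eq h.z_t] <;>
  match_scalars <;> field_simp <;> ring

end Straightening

/-- A relator of the presentation becomes zero in the quotient. -/
lemma mk_eq_zero {a : FreeAlgebra k (Fin 4)} (ha : a ∈ rels k q) :
    RingQuot.mkAlgHom k (rel k q) a = 0 := by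
  rw [RingQuot.mkAlgHom_rel k (s := rel k q) ⟨ha, rfl⟩, map_zero]

lemma straightening_mk (hq : q ≠ 0) :
    Straightening k q (RingQuot.mkAlgHom k (rel k q) (x1 k)) (RingQuot.mkAlgHom k (rel k q) (y k))
      (RingQuot.mkAlgHom k (rel k q) (x2 k)) (RingQuot.mkAlgHom k (rel k q) (u k))
      (RingQuot.mkAlgHom k (rel k q) (z k q)) (RingQuot.mkAlgHom k (rel k q) (t k q)) := by
  have hrel : ∀ a ∈ rels k q, RingQuot.mkAlgHom k (rel k q) a = 0 := fun a ha => mk_eq_zero k q ha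
  have hz : RingQuot.mkAlgHom k (rel k q) (z k q) = _ := congrArg _ (z.eq_1 k q)
  have ht : RingQuot.mkAlgHom k (rel k q) (t k q) = _ := congrArg _ (t.eq_1 k q)
  simp only [rels, Set.mem_insert_iff, Set.mem_singleton_iff, forall_eq_or_imp, forall_eq] at hrel
  simp only [map_add, map_sub, map_mul, map_pow, map_smul] at hrel hz ht
  generalize RingQuot.mkAlgHom k (rel k q) (x1 k) = X1 at *
  generalize RingQuot.mkAlgHom k (rel k q) (y k) = Y at *
  generalize RingQuot.mkAlgHom k (rel k q) (x2 k) = X2 at *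
  generalize RingQuot.mkAlgHom k (rel k q) (u k) = U at *
  generalize RingQuot.mkAlgHom k (rel k q) (z k q) = Z at *
  generalize RingQuot.mkAlgHom k (rel k q) (t k q) = T at *
  obtain ⟨h1, h2, h3, h4, h5, h6, h7, h8, h9, h10, h11, h12⟩ := hrel
  simp only [pow_two, sub_mul, add_mul, smul_sub, smul_add, smul_mul_assoc] at *
  constructor
  · exact h1
  · exact h2
  · exact eq_neg_of_add_eq_zero_left h3
  · rw [hz]; abel
  · rw [ht, mul_smul]; abel
  · exact sub_eq_zero.mp h4
  · rw [← sub_eq_zero, ← h7, mul_smul]; abel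
  · exact h5
  · exact h10
  · exact eq_neg_of_add_eq_zero_right h11
  · rw [sub_eq_zero.mp h6, smul_inv_smul₀ hq]
  · exact sub_eq_zero.mp h8
  · rw [mul_smul]; exact sub_eq_zero.mp h9
  · rw [eq_comm, ← sub_eq_zero, ← h12]; abel

lemma span_range_mon [CharZero k] (hq : q ≠ 0) : Submodule.span k (Set.range (mon k q)) = ⊤ := by
  have h := straightening_mk k q hq
  have hrange : Submodule.span k (Set.range (mon k q)) = LinearMap.range h.toAlg := by
    rw [Straightening.toAlg, Finsupp.range_linearCombination]
    congr 2
    ext i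
    simp [mon]
  have hmul : ∀ a : FreeAlgebra k (Fin 4), ∀ v, ∃ w,
      h.toAlg w = h.toAlg v * RingQuot.mkAlgHom k (rel k q) a := by
    intro a
    induction a with
    | grade0 c => exact fun v => ⟨c • v, by simp [Algebra.algebraMap_eq_smul_one]⟩
    | grade1 i =>
      intro v
      fin_cases i
      exacts [⟨_, h.toAlg_rx1 v⟩, ⟨_, h.toAlg_ry v⟩, ⟨_, h.toAlg_rx2 v⟩, ⟨_, h.toAlg_ru v⟩]
    | mul a b iha ihb =>
      intro v
      obtain ⟨w, hw⟩ := iha v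
      obtain ⟨w', hw'⟩ := ihb w
      exact ⟨w', by rw [hw', hw, map_mul, mul_assoc]⟩
    | add a b iha ihb =>
      intro v
      obtain ⟨w, hw⟩ := iha v
      obtain ⟨w', hw'⟩ := ihb v
      exact ⟨w + w', by rw [map_add, hw, hw', map_add, mul_add]⟩
  rw [hrange, eq_top_iff]
  rintro x -
  obtain ⟨a, rfl⟩ := RingQuot.mkAlgHom_surjective k (rel k q) x
  obtain ⟨w, hw⟩ := hmul a (e 0 0 0 0 0 0)
  exact ⟨w, by simpa [h.toAlg_e] using hw⟩

/-- The right action of the free algebra on the model. -/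
def act : FreeAlgebra k (Fin 4) →ₐ[k] (Module.End k (Idx →₀ k))ᵐᵒᵖ :=
  FreeAlgebra.lift k
    ![MulOpposite.op (rx1 k), MulOpposite.op (ry k), MulOpposite.op (rx2 k q),
      MulOpposite.op (ru k q)]

@[simp] lemma act_x1 : act k q (x1 k) = MulOpposite.op (rx1 k) := by simp [act, x1]

@[simp] lemma act_y : act k q (y k) = MulOpposite.op (ry k) := by simp [act, y]

@[simp] lemma act_x2 : act k q (x2 k) = MulOpposite.op (rx2 k q) := by simp [act, x2]

@[simp] lemma act_u : act k q (u k) = MulOpposite.op (ru k q) := by simp [act, u]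

@[simp] lemma act_z [CharZero k] : act k q (z k q) = MulOpposite.op (rz k q) := by
  simp [z, ← rx2_mul_ry, MulOpposite.op_sub, MulOpposite.op_smul]

@[simp] lemma act_t [CharZero k] : act k q (t k q) = MulOpposite.op (rt k q) := by
  simp [t, ← ru_mul_ry, MulOpposite.op_sub, MulOpposite.op_smul]

lemma act_rels [CharZero k] (hq : q ≠ 0) {a : FreeAlgebra k (Fin 4)} (ha : a ∈ rels k q) :
    act k q a = 0 := by
  apply MulOpposite.unop_injective
  simp only [rels, Set.mem_insert_iff, Set.mem_singleton_iff] at ha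
  rcases ha with rfl | rfl | rfl | rfl | rfl | rfl | rfl | rfl | rfl | rfl | rfl | rfl <;>
    simp only [map_add, map_sub, map_mul, map_smul, act_x1, act_y, act_x2, act_u, act_z,
      act_t, pow_two, MulOpposite.unop_add, MulOpposite.unop_sub, MulOpposite.unop_mul,
      MulOpposite.unop_smul, MulOpposite.unop_op, MulOpposite.unop_zero]
  exacts [rx1_mul_rx1 k, ry_mul_ry k, ry_mul_rx1 k, rx2_mul_rx1 k q, rz_mul_rz k q,
    rz_mul_rx2 k q hq, ru_mul_rx1 k q, rx2_mul_rt k q, ru_mul_rt k q, rt_mul_rt k q,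
    rz_mul_rt k q, rx2_mul_ru k q]

lemma ru_pow_e (a : ℕ) : (ru k q ^ a) (e 0 0 0 0 0 0) = e a 0 0 0 0 0 := by
  induction a with
  | zero => simp
  | succ a ih => rw [pow_succ', Module.End.mul_apply, ih]; simp [ru, insU, insX]

lemma rx2_pow_e (a b : ℕ) : (rx2 k q ^ b) (e a 0 0 0 0 0) = e a b 0 0 0 0 := by
  induction b with
  | zero => simp
  | succ b ih => rw [pow_succ', Module.End.mul_apply, ih]; simp [rx2, insX]

lemma linearIndependent_mon [CharZero k] (hq : q ≠ 0) : LinearIndependent k (mon k q) := by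
  let ψ : RingQuot (rel k q) →ₐ[k] (Module.End k (Idx →₀ k))ᵐᵒᵖ :=
    RingQuot.liftAlgHom k ⟨act k q, fun a b h => by rw [h.2, map_zero, act_rels k q hq h.1]⟩
  let f : RingQuot (rel k q) →ₗ[k] (Idx →₀ k) :=
    LinearMap.applyₗ (e 0 0 0 0 0 0) ∘ₗ (MulOpposite.opLinearEquiv k).symm.toLinearMap ∘ₗ
      ψ.toLinearMap
  have hf : f ∘ mon k q = fun i => Finsupp.single i 1 := by
    funext ⟨a, b, c, d, r, s⟩
    simp only [Function.comp_apply, f, ψ, LinearMap.comp_apply, mon, AlgHom.toLinearMap_apply,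
      RingQuot.liftAlgHom_mkAlgHom_apply, map_mul, map_pow, act_x1, act_y, act_x2, act_u, act_z,
      act_t, LinearEquiv.coe_coe, MulOpposite.coe_opLinearEquiv_symm, MulOpposite.unop_mul,
      MulOpposite.unop_pow, MulOpposite.unop_op, LinearMap.applyₗ_apply_apply, Module.End.mul_apply,
      ru_pow_e, rx2_pow_e]
    rcases fin_two_cases c with rfl | rfl <;> rcases fin_two_cases d with rfl | rfl <;>
    rcases fin_two_cases r with rfl | rfl <;> rcases fin_two_cases s with rfl | rfl <;>
    simp [rx1, ry, rz, rt, insZ, insT] <;> rfl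
  apply LinearIndependent.of_comp f
  rw [hf]
  exact Finsupp.linearIndependent_single_one k Idx

theorem statement15 [IsAlgClosed k] [CharZero k] (hq : q ≠ 0) :
    LinearIndependent k (mon k q) ∧
      Submodule.span k (Set.range (mon k q)) = ⊤ :=
  ⟨linearIndependent_mon k q hq, span_range_mon k q hq⟩

end Stmt15
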